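/- arXiv:0907.3848 — 5 statements merged into one kernel-verified Lean document; each statement's English description precedes it below -/
import Mathlib

section
/- For all real V > 0 and ε > 0, the complex-valued integral ∫_ℝ sin(Vx)/(x + iε)² dx equals −iπV·e^{−Vε}. In particular, ∫_ℝ sin(Vx)/(x + iε)² dx → −iπV as ε → 0⁺. -/
open MeasureTheory Topology

open scoped FourierTransform

lemma integrable_max_mul_exp_neg {ε : ℝ} (hε : 0 < ε) :
    Integrable fun t : ℝ => ((max t 0 * Real.exp (-ε * t) : ℝ) : ℂ) := by
  suffices Integrable fun t : ℝ => max t 0 * Real.exp (-ε * t) from this.ofReal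
  have h := integrableOn_rpow_mul_exp_neg_mul_rpow (p := 1) (s := 1) (b := ε)
    (by norm_num) one_pos hε
  rw [← integrable_indicator_iff measurableSet_Ioi] at h
  refine h.congr (Filter.Eventually.of_forall fun t => ?_)
  rcases lt_or_ge 0 t with ht | ht
  · simp [ht, ht.le]
  · simp [ht, not_lt.mpr ht]

lemma norm_cexp_neg_mul_ofReal (r : ℂ) (t : ℝ) :
    ‖Complex.exp (-r * t)‖ = Real.exp (-r.re * t) := by
  simp [Complex.norm_exp]

lemma integral_Ioi_mul_cexp_neg_mul {r : ℂ} (hr : 0 < r.re) :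
    ∫ t : ℝ in Set.Ioi 0, (t : ℂ) * Complex.exp (-r * t) = (r ^ 2)⁻¹ := by
  have hr0 : r ≠ 0 := fun h => by simp [h] at hr
  have hderiv : ∀ t ∈ Set.Ici (0 : ℝ), HasDerivAt
      (fun t : ℝ => -(r⁻¹ * (t * Complex.exp (-r * t)) + (r ^ 2)⁻¹ * Complex.exp (-r * t)))
      ((t : ℂ) * Complex.exp (-r * t)) t := by
    intro t _
    have hid : HasDerivAt (fun t : ℝ => (t : ℂ)) 1 t := Complex.ofRealCLM.hasDerivAt
    have hexp := (hid.const_mul (-r)).cexp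
    convert! (((hid.mul hexp).const_mul r⁻¹).add (hexp.const_mul (r ^ 2)⁻¹)).neg using 1
    field_simp
    ring
  have hint : IntegrableOn (fun t : ℝ => (t : ℂ) * Complex.exp (-r * t)) (Set.Ioi 0) := by
    refine Integrable.mono (integrable_max_mul_exp_neg hr).integrableOn
      (Continuous.aestronglyMeasurable (by fun_prop)) ?_
    filter_upwards [ae_restrict_mem measurableSet_Ioi] with t ht
    rw [norm_mul, norm_cexp_neg_mul_ofReal, max_eq_left (le_of_lt ht), Complex.norm_real,
      Complex.norm_real, norm_mul, Real.norm_of_nonneg (Real.exp_nonneg _)]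
  have hexp0 : Filter.Tendsto (fun t : ℝ => Complex.exp (-r * t)) Filter.atTop (𝓝 0) := by
    rw [tendsto_zero_iff_norm_tendsto_zero]
    simp_rw [norm_cexp_neg_mul_ofReal]
    simpa using tendsto_rpow_mul_exp_neg_mul_atTop_nhds_zero 0 r.re hr
  have hmul0 : Filter.Tendsto (fun t : ℝ => (t : ℂ) * Complex.exp (-r * t))
      Filter.atTop (𝓝 0) := by
    rw [tendsto_zero_iff_norm_tendsto_zero]
    simp_rw [norm_mul, norm_cexp_neg_mul_ofReal, Complex.norm_real]
    refine (tendsto_rpow_mul_exp_neg_mul_atTop_nhds_zero 1 r.re hr).congr' ?_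
    filter_upwards [Filter.eventually_ge_atTop 0] with t ht
    rw [Real.rpow_one, Real.norm_of_nonneg ht]
  rw [integral_Ioi_of_hasDerivAt_of_tendsto' hderiv hint
    ((hmul0.const_mul r⁻¹).add (hexp0.const_mul (r ^ 2)⁻¹)).neg]
  simp

lemma fourier_max_mul_exp_neg {ε : ℝ} (hε : 0 < ε) (w : ℝ) :
    𝓕 (fun t : ℝ => ((max t 0 * Real.exp (-ε * t) : ℝ) : ℂ)) w =
      ((ε + 2 * Real.pi * w * Complex.I : ℂ) ^ 2)⁻¹ := by
  rw [← integral_Ioi_mul_cexp_neg_mul (by simpa using hε), Real.fourier_real_eq_integral_exp_smul,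
    ← integral_indicator measurableSet_Ioi]
  refine integral_congr_ae (Filter.Eventually.of_forall fun t => ?_)
  rcases lt_or_ge 0 t with ht | ht
  · simp only [Set.indicator, Set.mem_Ioi, ht, if_true, max_eq_left ht.le, smul_eq_mul]
    push_cast
    rw [mul_left_comm, ← Complex.exp_add]
    ring_nf
  · simp [ht, not_lt.mpr ht]

lemma integrable_inv_add_mul_I_sq {ε : ℝ} (hε : 0 < ε) :
    Integrable fun x : ℝ => (((x : ℂ) + ε * Complex.I) ^ 2)⁻¹ := by
  have h := ((integrable_inv_one_add_sq.comp_mul_left' (inv_ne_zero hε.ne')).const_mul (ε ^ 2)⁻¹)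
  refine h.mono' (Measurable.aestronglyMeasurable (by fun_prop))
    (Filter.Eventually.of_forall fun x => le_of_eq ?_)
  rw [norm_inv, norm_pow, ← Complex.normSq_eq_norm_sq, Complex.normSq_add_mul_I, ← mul_inv]
  congr 1
  field_simp
  ring

lemma integral_cexp_div_add_mul_I_sq {ε : ℝ} (hε : 0 < ε) (v : ℝ) :
    ∫ x : ℝ, Complex.exp (-(v * x) * Complex.I) * (((x : ℂ) + ε * Complex.I) ^ 2)⁻¹ =
      -2 * Real.pi * (max v 0 * Real.exp (-ε * v) : ℝ) := by
  have hpi : (2 * Real.pi) ≠ 0 := by positivity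
  set f : ℝ → ℂ := fun t => ((max t 0 * Real.exp (-ε * t) : ℝ) : ℂ) with hf
  have hF : ∀ w : ℝ, 𝓕 f w = -((((-(2 * Real.pi) * w : ℝ) : ℂ) + ε * Complex.I) ^ 2)⁻¹ := by
    intro w
    rw [hf, fourier_max_mul_exp_neg hε, ← inv_neg]
    congr 1
    push_cast
    linear_combination (ε ^ 2 + (2 * Real.pi * w) ^ 2 : ℂ) * Complex.I_sq
  have hFi : Integrable (𝓕 f) := by
    rw [funext hF]
    exact ((integrable_inv_add_mul_I_sq hε).comp_mul_left' (neg_ne_zero.mpr hpi)).neg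
  have hinv := congrFun (Continuous.fourierInv_fourier_eq (f := f)
    (by rw [hf]; fun_prop) (integrable_max_mul_exp_neg hε) hFi) v
  rw [Real.fourierInv_eq'] at hinv
  have hsub := Measure.integral_comp_mul_left (fun x : ℝ =>
    Complex.exp (-(v * x) * Complex.I) * (((x : ℂ) + ε * Complex.I) ^ 2)⁻¹) (-(2 * Real.pi))
  have heq : ∫ w : ℝ, Complex.exp (((2 * Real.pi * inner ℝ w v : ℝ) : ℂ) * Complex.I) • 𝓕 f w =
      -∫ w : ℝ, Complex.exp (-(v * ((-(2 * Real.pi) * w : ℝ) : ℂ)) * Complex.I) *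
        ((((-(2 * Real.pi) * w : ℝ) : ℂ) + ε * Complex.I) ^ 2)⁻¹ := by
    rw [← integral_neg]
    congr 1
    ext w
    rw [hF, smul_eq_mul, mul_neg]
    congr 3
    simp
    ring
  rw [heq, hsub, abs_inv, abs_neg, abs_of_pos (by positivity)] at hinv
  change _ = -2 * Real.pi * f v
  rw [← hinv, Complex.real_smul]
  have : (Real.pi : ℂ) ≠ 0 := by exact_mod_cast Real.pi_ne_zero
  generalize (∫ y : ℝ, Complex.exp (-(v * y) * Complex.I) *
    (((y : ℂ) + ε * Complex.I) ^ 2)⁻¹) = J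
  push_cast
  field_simp

lemma integral_sin_div_add_mul_I_sq {V ε : ℝ} (hV : 0 < V) (hε : 0 < ε) :
    ∫ x : ℝ, (Real.sin (V * x) : ℂ) / ((x : ℂ) + ε * Complex.I) ^ 2 =
      -Complex.I * Real.pi * V * Real.exp (-(V * ε)) := by
  have hint : ∀ v : ℝ, Integrable fun x : ℝ =>
      Complex.exp (-(v * x) * Complex.I) * (((x : ℂ) + ε * Complex.I) ^ 2)⁻¹ := by
    intro v
    refine (integrable_inv_add_mul_I_sq hε).bdd_mul (c := 1)
      (Continuous.aestronglyMeasurable (by fun_prop)) (Filter.Eventually.of_forall fun x => ?_)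
    have := Complex.norm_exp_ofReal_mul_I (-(v * x))
    push_cast at this
    exact this.le
  have hsplit : ∀ x : ℝ, (Real.sin (V * x) : ℂ) / ((x : ℂ) + ε * Complex.I) ^ 2 =
      Complex.I / 2 *
        (Complex.exp (-(V * x) * Complex.I) * (((x : ℂ) + ε * Complex.I) ^ 2)⁻¹ -
          Complex.exp (-((-V : ℝ) * x) * Complex.I) * (((x : ℂ) + ε * Complex.I) ^ 2)⁻¹) := by
    intro x
    rw [Complex.ofReal_sin, Complex.sin]
    push_cast
    rw [neg_mul (V : ℂ), neg_neg]
    ring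
  simp_rw [hsplit]
  rw [integral_const_mul, integral_sub (hint V) (hint (-V)), integral_cexp_div_add_mul_I_sq hε,
    integral_cexp_div_add_mul_I_sq hε, max_eq_left hV.le, max_eq_right (by linarith),
    show -ε * V = -(V * ε) by ring]
  push_cast
  ring

/-- For `V > 0` and `ε > 0`, `∫_ℝ sin(Vx)/(x + iε)² dx = -iπV e^{-Vε}`;
in particular the integral tends to `-iπV` as `ε → 0⁺`. -/
theorem stmt10 (V : ℝ) (hV : 0 < V) :
    (∀ ε : ℝ, 0 < ε →
      ∫ x : ℝ, (Real.sin (V * x) : ℂ) / ((x : ℂ) + ε * Complex.I) ^ 2 =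
        -Complex.I * Real.pi * V * Real.exp (-(V * ε))) ∧
    Filter.Tendsto
      (fun ε : ℝ => ∫ x : ℝ, (Real.sin (V * x) : ℂ) / ((x : ℂ) + ε * Complex.I) ^ 2)
      (𝓝[>] (0:ℝ)) (nhds (-Complex.I * Real.pi * V)) := by
  refine ⟨fun ε hε => integral_sin_div_add_mul_I_sq hV hε, ?_⟩
  have hcont : Continuous fun ε : ℝ =>
      -Complex.I * Real.pi * V * (Real.exp (-(V * ε)) : ℂ) := by fun_prop
  have hlim := (hcont.tendsto 0).mono_left (nhdsWithin_le_nhds (s := Set.Ioi 0))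
  simp only [mul_zero, neg_zero, Real.exp_zero, Complex.ofReal_one, mul_one] at hlim
  refine hlim.congr' ?_
  filter_upwards [self_mem_nhdsWithin] with ε hε
  exact (integral_sin_div_add_mul_I_sq hV hε).symm
end

section
/- For all real a, b and every ε > 0, the complex-valued integral ∫_ℝ 1/((a − x − iε)·(x − b − iε)) dx equals 2πi/(a − b − 2iε). -/
open MeasureTheory

open Filter Topology Complex

lemma integrable_inv_sub_sq_add_sq (a ε : ℝ) (hε : 0 < ε) :
    Integrable fun x : ℝ ↦ ((x - a) ^ 2 + ε ^ 2)⁻¹ := by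
  have h := ((integrable_inv_one_add_sq.comp_div hε.ne').comp_sub_right a).const_mul (ε ^ 2)⁻¹
  refine h.congr (ae_of_all _ fun x ↦ ?_)
  dsimp only
  rw [← mul_inv]
  congr 1
  field_simp
  ring

lemma norm_sq_sub_sub_mul_I (a b ε : ℝ) : ‖(a : ℂ) - b - ε * I‖ ^ 2 = (b - a) ^ 2 + ε ^ 2 := by
  rw [← Complex.normSq_eq_norm_sq, Complex.normSq_apply]
  simp
  ring

lemma sub_sub_mul_I_ne_zero (a b : ℝ) {ε : ℝ} (hε : 0 < ε) : (a : ℂ) - b - ε * I ≠ 0 := by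
  intro h
  have := congrArg Complex.im h
  simp at this
  exact hε.ne' this

lemma integrable_one_div_resolvent_mul (a b ε : ℝ) (hε : 0 < ε) :
    Integrable fun x : ℝ ↦ 1 / (((a : ℂ) - x - ε * I) * ((x : ℂ) - b - ε * I)) := by
  refine ((integrable_inv_sub_sq_add_sq a ε hε).add (integrable_inv_sub_sq_add_sq b ε hε)).mono'
    (Continuous.aestronglyMeasurable ?_) (ae_of_all _ fun x ↦ ?_)
  · refine Continuous.div (by fun_prop) (by fun_prop) fun x ↦ ?_
    exact mul_ne_zero (sub_sub_mul_I_ne_zero a x hε) (sub_sub_mul_I_ne_zero x b hε)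
  · have hu := norm_sq_sub_sub_mul_I a x ε
    have hv := norm_sq_sub_sub_mul_I x b ε
    rw [Pi.add_apply, ← hu, show (x - b) ^ 2 = (b - x) ^ 2 by ring, ← hv, norm_div, norm_mul,
      norm_one, one_div, mul_inv, ← inv_pow, ← inv_pow]
    nlinarith [sq_nonneg (‖(a : ℂ) - x - ε * I‖⁻¹ - ‖(x : ℂ) - b - ε * I‖⁻¹),
      sq_nonneg ‖(a : ℂ) - x - ε * I‖⁻¹, sq_nonneg ‖(x : ℂ) - b - ε * I‖⁻¹]

lemma im_resolvent_ratio (a b x ε : ℝ) :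
    (((x : ℂ) - b - ε * I) / ((a : ℂ) - x - ε * I)).im =
      ε * (2 * x - a - b) / ((x - a) ^ 2 + ε ^ 2) := by
  rw [Complex.div_im, Complex.normSq_eq_norm_sq, norm_sq_sub_sub_mul_I]
  simp
  ring

lemma re_resolvent_ratio (a b x ε : ℝ) :
    (((x : ℂ) - b - ε * I) / ((a : ℂ) - x - ε * I)).re =
      ((x - b) * (a - x) + ε ^ 2) / ((x - a) ^ 2 + ε ^ 2) := by
  rw [Complex.div_re, Complex.normSq_eq_norm_sq, norm_sq_sub_sub_mul_I]
  simp
  ring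

lemma resolvent_ratio_mem_slitPlane (a b x ε : ℝ) (hε : 0 < ε) :
    ((x : ℂ) - b - ε * I) / ((a : ℂ) - x - ε * I) ∈ slitPlane := by
  rw [mem_slitPlane_iff, re_resolvent_ratio, im_resolvent_ratio]
  have hd : 0 < (x - a) ^ 2 + ε ^ 2 := by positivity
  by_cases h : 2 * x - a - b = 0
  · left
    have hb : x - b = a - x := by linarith
    rw [hb]
    exact div_pos (by nlinarith [mul_self_nonneg (a - x), pow_pos hε 2]) hd
  · right
    exact div_ne_zero (mul_ne_zero hε.ne' h) hd.ne'

lemma tendsto_resolvent_ratio (a b ε : ℝ) (hε : 0 < ε) {l : Filter ℝ}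
    (hl : Tendsto (fun x : ℝ ↦ |x|) l atTop) :
    Tendsto (fun x : ℝ ↦ ((x : ℂ) - b - ε * I) / ((a : ℂ) - x - ε * I)) l (𝓝 (-1)) := by
  have hinv : Tendsto (fun x : ℝ ↦ ((a : ℂ) - x - ε * I)⁻¹) l (𝓝 0) := by
    refine tendsto_inv₀_cobounded.comp (tendsto_norm_atTop_iff_cobounded.mp ?_)
    refine tendsto_atTop_mono (fun x ↦ ?_) (tendsto_atTop_add_const_right l (-|a|) hl)
    have h := Complex.abs_re_le_norm ((a : ℂ) - x - ε * I)
    simp only [sub_re, ofReal_re, mul_re, I_re, mul_zero, ofReal_im, I_im, mul_one, sub_zero] at h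
    have h' := abs_sub_abs_le_abs_sub x a
    rw [abs_sub_comm] at h'
    linarith
  have h := (hinv.const_mul ((a : ℂ) - b - 2 * ε * I)).sub_const 1
  rw [mul_zero, zero_sub] at h
  refine h.congr fun x ↦ ?_
  have := sub_sub_mul_I_ne_zero a x hε
  field_simp
  ring

lemma tendsto_log_resolvent_ratio_atTop (a b ε : ℝ) (hε : 0 < ε) :
    Tendsto (fun x : ℝ ↦ log (((x : ℂ) - b - ε * I) / ((a : ℂ) - x - ε * I))) atTop
      (𝓝 (Real.pi * I)) := by
  have h := (continuousWithinAt_log_of_re_neg_of_im_zero (z := -1) (by simp) (by simp)).tendsto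
  rw [log_neg_one] at h
  refine h.comp (tendsto_nhdsWithin_iff.mpr
    ⟨tendsto_resolvent_ratio a b ε hε tendsto_abs_atTop_atTop, ?_⟩)
  filter_upwards [eventually_ge_atTop ((a + b) / 2)] with x hx
  rw [im_resolvent_ratio]
  exact div_nonneg (mul_nonneg hε.le (by linarith)) (by positivity)

lemma tendsto_log_resolvent_ratio_atBot (a b ε : ℝ) (hε : 0 < ε) :
    Tendsto (fun x : ℝ ↦ log (((x : ℂ) - b - ε * I) / ((a : ℂ) - x - ε * I))) atBot
      (𝓝 (-(Real.pi * I))) := by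
  have h := tendsto_log_nhdsWithin_im_neg_of_re_neg_of_im_zero (z := -1) (by simp) (by simp)
  rw [norm_neg, norm_one, Real.log_one, ofReal_zero, zero_sub] at h
  refine h.comp (tendsto_nhdsWithin_iff.mpr
    ⟨tendsto_resolvent_ratio a b ε hε tendsto_abs_atBot_atTop, ?_⟩)
  filter_upwards [eventually_lt_atBot ((a + b) / 2)] with x hx
  rw [im_resolvent_ratio]
  exact div_neg_of_neg_of_pos (mul_neg_of_pos_of_neg hε (by linarith)) (by positivity)

lemma hasDerivAt_log_resolvent_ratio (a b x ε : ℝ) (hε : 0 < ε) :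
    HasDerivAt (fun x : ℝ ↦ log (((x : ℂ) - b - ε * I) / ((a : ℂ) - x - ε * I)))
      (((a : ℂ) - b - 2 * ε * I) *
        (1 / (((a : ℂ) - x - ε * I) * ((x : ℂ) - b - ε * I)))) x := by
  have hx : HasDerivAt (fun x : ℝ ↦ (x : ℂ)) 1 x := Complex.ofRealCLM.hasDerivAt
  have hu := sub_sub_mul_I_ne_zero a x hε
  have hv := sub_sub_mul_I_ne_zero x b hε
  have h := ((((hx.sub_const (b : ℂ)).sub_const (ε * I)).fun_div
    ((hx.const_sub (a : ℂ)).sub_const (ε * I)) hu).clog_real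
    (resolvent_ratio_mem_slitPlane a b x ε hε))
  convert h using 1
  field_simp
  ring

/-- For real `a`, `b` and `ε > 0`:
`∫_ℝ dx / ((a - x - iε)(x - b - iε)) = 2πi / (a - b - 2iε)`. -/
theorem stmt11 (a b ε : ℝ) (hε : 0 < ε) :
    ∫ x : ℝ, 1 / (((a : ℂ) - x - ε * Complex.I) * ((x : ℂ) - b - ε * Complex.I)) =
      2 * Real.pi * Complex.I / ((a : ℂ) - b - 2 * ε * Complex.I) := by
  have h := integral_of_hasDerivAt_of_tendsto
    (fun x ↦ hasDerivAt_log_resolvent_ratio a b x ε hε)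
    ((integrable_one_div_resolvent_mul a b ε hε).const_mul _)
    (tendsto_log_resolvent_ratio_atBot a b ε hε) (tendsto_log_resolvent_ratio_atTop a b ε hε)
  rw [integral_const_mul] at h
  have hc : (a : ℂ) - b - 2 * ε * I ≠ 0 := by
    simpa using sub_sub_mul_I_ne_zero a b (mul_pos two_pos hε)
  rw [eq_div_iff hc, mul_comm, h]
  ring
end

section
/- Let V > 0 and define F(t₁,t₂,t₃) = [sin(V(t₁−t₂)) + sin(V(t₂−t₃)) + sin(V(t₃−t₁))] / ((t₁−t₂)(t₂−t₃)(t₁−t₃)) whenever the three times are pairwise distinct (the set where the denominator vanishes has measure zero, and the value there is irrelevant; F extends to a bounded function). Then (1/t)·∫_{[0,t]³} F(t₁,t₂,t₃) dt₁dt₂dt₃ → 2π²V as t → ∞. -/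
open MeasureTheory

open Real Filter Topology FourierTransform

theorem integral_cexp_mul_I_eq_sinc (r : ℝ) :
    ∫ y in (-1 : ℝ)..1, Complex.exp ((r * y : ℝ) * Complex.I) = 2 * sinc r := by
  rcases eq_or_ne r 0 with rfl | hr
  · norm_num
  · have h := intervalIntegral.integral_comp_mul_left (a := -1) (b := 1)
      (fun x : ℝ => Complex.exp (x * Complex.I)) hr
    have hr' : (r : ℂ) ≠ 0 := by exact_mod_cast hr
    rw [h, mul_neg_one, mul_one, integral_exp_mul_I_eq_sinc, Complex.real_smul]
    push_cast
    field_simp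

/-- The modulated box function `y ↦ exp (i u y)` on `[-1, 1]`. -/
noncomputable def modulatedBox (u : ℝ) : ℝ → ℂ :=
  (Set.Icc (-1 : ℝ) 1).indicator fun y => Complex.exp ((u * y : ℝ) * Complex.I)

theorem integrable_modulatedBox (u : ℝ) : Integrable (modulatedBox u) :=
  (integrable_indicator_iff measurableSet_Icc).2
    (Continuous.continuousOn (by fun_prop)).integrableOn_Icc

theorem norm_modulatedBox_le_one (u y : ℝ) : ‖modulatedBox u y‖ ≤ 1 :=
  (norm_indicator_le_norm_self _ _).trans (Complex.norm_exp_ofReal_mul_I _).le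

theorem continuousAt_modulatedBox (u : ℝ) {y : ℝ} (h₁ : y ≠ -1) (h₂ : y ≠ 1) :
    ContinuousAt (modulatedBox u) y := by
  refine ContinuousOn.continuousAt_indicator (Continuous.continuousOn (by fun_prop)) ?_
  rw [frontier_Icc (by norm_num)]
  simp [h₁, h₂]

theorem fourier_modulatedBox (u w : ℝ) :
    𝓕 (modulatedBox u) w = 2 * sinc (2 * π * w - u) := by
  rw [Real.fourier_real_eq_integral_exp_smul, ← neg_sub, sinc_neg, ← integral_cexp_mul_I_eq_sinc,
    intervalIntegral.integral_of_le (by norm_num), ← integral_Icc_eq_integral_Ioc,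
    ← integral_indicator measurableSet_Icc]
  congr 1 with v
  by_cases hv : v ∈ Set.Icc (-1 : ℝ) 1
  · simp only [modulatedBox, Set.indicator_of_mem hv, smul_eq_mul, ← Complex.exp_add]
    congr 1
    push_cast
    ring
  · simp [modulatedBox, Set.indicator_of_notMem hv]

theorem abs_sinc_le_two_div_one_add_abs (x : ℝ) : |sinc x| ≤ 2 * (1 + |x|)⁻¹ := by
  rw [← div_eq_mul_inv, le_div_iff₀ (by positivity)]
  have h₁ := abs_sinc_le_one x
  have h₂ : |sinc x| * |x| ≤ 1 := by
    rcases eq_or_ne x 0 with rfl | hx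
    · simp
    · rw [sinc_of_ne_zero hx, abs_div, div_mul_cancel₀ _ (abs_ne_zero.2 hx)]
      exact abs_sin_le_one x
  linarith

theorem memLp_two_sinc : MemLp sinc 2 := by
  rw [memLp_two_iff_integrable_sq continuous_sinc.aestronglyMeasurable]
  refine ((integrable_one_add_norm (E := ℝ) (μ := volume) (r := 2) (by norm_num)).const_mul 4).mono'
    (by fun_prop) (ae_of_all _ fun x => ?_)
  have h := abs_sinc_le_two_div_one_add_abs x
  rw [norm_eq_abs, norm_eq_abs, abs_pow, rpow_neg (by positivity), rpow_two]
  calc |sinc x| ^ 2 ≤ (2 * (1 + |x|)⁻¹) ^ 2 := by gcongr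
    _ = _ := by rw [mul_pow, inv_pow]; norm_num

theorem integrable_sinc_mul_sinc_sub (u : ℝ) : Integrable fun v => sinc v * sinc (v - u) :=
  memLp_two_sinc.integrable_mul
    (memLp_two_sinc.comp_measurePreserving (measurePreserving_sub_right volume u))

theorem integral_sinc_mul_sinc_sub (u : ℝ) : ∫ v, sinc v * sinc (v - u) = π * sinc u := by
  set h : ℝ → ℂ :=
    convolution (modulatedBox u) (modulatedBox 0) (ContinuousLinearMap.mul ℂ ℂ) volume with hh
  have hint : Integrable h :=
    (integrable_modulatedBox u).integrable_convolution _ (integrable_modulatedBox 0)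
  have hF : 𝓕 h = fun w => ((4 * (sinc (2 * π * w) * sinc (2 * π * w - u)) : ℝ) : ℂ) := by
    ext w
    rw [hh, Real.fourier_mul_convolution_eq (integrable_modulatedBox u) (integrable_modulatedBox 0),
      fourier_modulatedBox, fourier_modulatedBox]
    push_cast
    ring_nf
  have hFint : Integrable (𝓕 h) := by
    rw [hF]
    exact (((integrable_sinc_mul_sinc_sub u).comp_mul_left' (R := 2 * π)
      (by positivity)).const_mul 4).ofReal
  have hcont : ContinuousAt h 0 := by
    refine continuousAt_of_dominated (bound := fun y => ‖modulatedBox u y‖)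
      (Eventually.of_forall fun x => ?_) (Eventually.of_forall fun x => ae_of_all _ fun y => ?_)
      (integrable_modulatedBox u).norm ?_
    · exact (integrable_modulatedBox u).aestronglyMeasurable.mul
        ((integrable_modulatedBox 0).comp_sub_left x).aestronglyMeasurable
    · rw [ContinuousLinearMap.mul_apply', norm_mul]
      exact mul_le_of_le_one_right (norm_nonneg _) (norm_modulatedBox_le_one _ _)
    · filter_upwards [volume.ae_ne (-1 : ℝ), volume.ae_ne (1 : ℝ)] with y h₁ h₂
      have : ContinuousAt (modulatedBox 0) (0 - y) :=
        continuousAt_modulatedBox 0 (fun h => h₂ (by linarith)) (fun h => h₁ (by linarith))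
      exact continuousAt_const.mul
        (ContinuousAt.comp (f := fun x : ℝ => x - y) this (by fun_prop))
  have h0 : h 0 = 2 * sinc u := by
    rw [← integral_cexp_mul_I_eq_sinc,
      intervalIntegral.integral_of_le (by norm_num), ← integral_Icc_eq_integral_Ioc,
      ← integral_indicator measurableSet_Icc]
    refine integral_congr_ae (ae_of_all _ fun y => ?_)
    by_cases hy : y ∈ Set.Icc (-1 : ℝ) 1
    · have hy' : -y ∈ Set.Icc (-1 : ℝ) 1 := ⟨by linarith [hy.2], by linarith [hy.1]⟩
      simp [modulatedBox, Set.indicator_of_mem hy, Set.indicator_of_mem hy']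
    · simp [modulatedBox, Set.indicator_of_notMem hy]
  have key := hint.fourierInv_fourier_eq hFint hcont
  rw [Real.fourierInv_eq', h0, hF] at key
  simp only [inner_zero_right, mul_zero, Complex.ofReal_zero, zero_mul, Complex.exp_zero,
    one_smul] at key
  rw [integral_complex_ofReal, integral_const_mul] at key
  have hs := Measure.integral_comp_mul_left (fun v => sinc v * sinc (v - u)) (2 * π)
  rw [hs, abs_of_pos (by positivity), smul_eq_mul] at key
  have key' : 4 * ((2 * π)⁻¹ * ∫ v, sinc v * sinc (v - u)) = 2 * sinc u := by exact_mod_cast key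
  field_simp at key'
  linarith

theorem mul_mul_le_sum_rpow {a b c : ℝ} (ha : 0 ≤ a) (hb : 0 ≤ b) (hc : 0 ≤ c) :
    a * b * c ≤ a ^ (3 / 2 : ℝ) * b ^ (3 / 2 : ℝ) + b ^ (3 / 2 : ℝ) * c ^ (3 / 2 : ℝ)
      + a ^ (3 / 2 : ℝ) * c ^ (3 / 2 : ℝ) := by
  have hp : ∀ {x : ℝ}, 0 ≤ x → √x ^ 3 = x ^ (3 / 2 : ℝ) := fun {x} hx => by
    rw [sqrt_eq_rpow, ← rpow_natCast, ← rpow_mul hx]; norm_num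
  rw [← hp ha, ← hp hb, ← hp hc]
  nth_rw 1 [← sq_sqrt ha, ← sq_sqrt hb, ← sq_sqrt hc]
  generalize ha' : √a = x
  generalize hb' : √b = y
  generalize hc' : √c = z
  have hx : 0 ≤ x := ha' ▸ sqrt_nonneg a
  have hy : 0 ≤ y := hb' ▸ sqrt_nonneg b
  have hz : 0 ≤ z := hc' ▸ sqrt_nonneg c
  have amgm : ∀ p q r : ℝ, 0 ≤ p → 0 ≤ q → 0 ≤ r → p * q * r ≤ p ^ 3 + q ^ 3 + r ^ 3 := by
    intro p q r hp hq hr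
    nlinarith [mul_nonneg (add_nonneg (add_nonneg hp hq) hr)
      (add_nonneg (add_nonneg (sq_nonneg (p - q)) (sq_nonneg (q - r))) (sq_nonneg (p - r))),
      pow_nonneg hp 3, pow_nonneg hq 3, pow_nonneg hr 3]
  have := amgm (x * y) (y * z) (x * z) (by positivity) (by positivity) (by positivity)
  linarith

theorem integrable_abs_sinc_rpow : Integrable fun x => |sinc x| ^ (3 / 2 : ℝ) := by
  refine ((integrable_one_add_norm (E := ℝ) (μ := volume) (r := 3 / 2)
    (by norm_num)).const_mul (2 ^ (3 / 2 : ℝ))).mono'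
    ((continuous_sinc.abs.rpow_const fun _ => Or.inr (by norm_num)).aestronglyMeasurable)
    (ae_of_all _ fun x => ?_)
  rw [norm_of_nonneg (by positivity), norm_eq_abs, rpow_neg (by positivity),
    ← inv_rpow (by positivity), ← mul_rpow (by positivity) (by positivity)]
  exact rpow_le_rpow (abs_nonneg _) (abs_sinc_le_two_div_one_add_abs x) (by norm_num)

/-- The product `sinc x * sinc z * sinc (z - x)`. -/
noncomputable def sincTriple (q : ℝ × ℝ) : ℝ := sinc q.1 * sinc q.2 * sinc (q.2 - q.1)

theorem continuous_sincTriple : Continuous sincTriple := by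
  unfold sincTriple
  fun_prop

theorem abs_sincTriple_le_one (q : ℝ × ℝ) : |sincTriple q| ≤ 1 := by
  rw [sincTriple, abs_mul, abs_mul]
  exact mul_le_one₀ (mul_le_one₀ (abs_sinc_le_one _) (abs_nonneg _) (abs_sinc_le_one _))
    (abs_nonneg _) (abs_sinc_le_one _)

theorem integrable_sincTriple : Integrable sincTriple := by
  have hprod := integrable_abs_sinc_rpow.mul_prod integrable_abs_sinc_rpow
  have h₁ : Integrable fun q : ℝ × ℝ =>
      |sinc q.1| ^ (3 / 2 : ℝ) * |sinc (q.2 - q.1)| ^ (3 / 2 : ℝ) :=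
    (measurePreserving_prod_sub volume volume).integrable_comp_of_integrable hprod
  have h₂ : Integrable fun q : ℝ × ℝ =>
      |sinc q.2| ^ (3 / 2 : ℝ) * |sinc (q.2 - q.1)| ^ (3 / 2 : ℝ) := by
    refine h₁.swap.congr (ae_of_all _ fun q => ?_)
    simp only [Function.comp_apply, Prod.fst_swap, Prod.snd_swap]
    rw [← neg_sub, sinc_neg]
  refine ((hprod.add h₂).add h₁).mono' continuous_sincTriple.aestronglyMeasurable
    (ae_of_all _ fun q => ?_)
  rw [norm_eq_abs, sincTriple, abs_mul, abs_mul]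
  exact mul_mul_le_sum_rpow (abs_nonneg _) (abs_nonneg _) (abs_nonneg _)

theorem integral_sincTriple : ∫ q, sincTriple q = π ^ 2 := by
  rw [Measure.volume_eq_prod, integral_prod _ integrable_sincTriple]
  have h : ∀ x, ∫ z, sincTriple (x, z) = π * (sinc x * sinc (x - 0)) := fun x => by
    simp only [sincTriple, mul_assoc]
    rw [integral_const_mul, integral_sinc_mul_sinc_sub, sub_zero]
    ring
  simp_rw [h]
  rw [integral_const_mul, integral_sinc_mul_sinc_sub, sinc_zero]
  ring

theorem tendsto_average_integral_sub {G : ℝ × ℝ → ℝ} (hm : Measurable G) (hG : Integrable G) :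
    Tendsto (fun t : ℝ => (1 / t) * ∫ s in Set.Icc 0 t,
      ∫ q in Set.Icc 0 t ×ˢ Set.Icc 0 t, G (s - q.1, s - q.2)) atTop (𝓝 (∫ q, G q)) := by
  set S : ℝ → Set (ℝ × ℝ) := fun t => Set.Icc 0 t ×ˢ Set.Icc 0 t
  have hSm : ∀ t, MeasurableSet (S t) := fun t => measurableSet_Icc.prod measurableSet_Icc
  set K : ℝ → ℝ → ℝ := fun t s => ∫ q, (S t).indicator 1 (s - q.1, s - q.2) * G q with hK
  have hKeq : ∀ t s, ∫ q in S t, G (s - q.1, s - q.2) = K t s := fun t s => by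
    rw [← integral_indicator (hSm t)]
    simp only [hK]
    rw [← integral_sub_left_eq_self (fun q : ℝ × ℝ => (S t).indicator 1 (s - q.1, s - q.2) * G q)
        volume (s, s)]
    refine integral_congr_ae (ae_of_all _ fun q => ?_)
    have hsub : (s, s) - q = (s - q.1, s - q.2) := rfl
    by_cases hq : q ∈ S t <;> simp [hq, hsub]
  have hle : ∀ t s q, ‖(S t).indicator (1 : ℝ × ℝ → ℝ) (s - q.1, s - q.2) * G q‖ ≤ ‖G q‖ :=
    fun t s q => by
      rw [norm_mul]
      refine mul_le_of_le_one_left (norm_nonneg _) ?_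
      exact (norm_indicator_le_norm_self _ _).trans (by simp)
  have hmeas : ∀ t, Measurable fun p : ℝ × ℝ × ℝ =>
      (S t).indicator (1 : ℝ × ℝ → ℝ) (p.1 - p.2.1, p.1 - p.2.2) * G p.2 := fun t =>
    ((measurable_one.indicator (hSm t)).comp (by fun_prop)).mul (hm.comp measurable_snd)
  have hmain : Tendsto (fun t : ℝ => ∫ σ in (0 : ℝ)..1, K t (t * σ)) atTop
      (𝓝 (∫ σ in (0 : ℝ)..1, ∫ q, G q)) := by
    refine intervalIntegral.tendsto_integral_filter_of_dominated_convergence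
      (fun _ => ∫ q, ‖G q‖) (Eventually.of_forall fun t => ?_)
      (Eventually.of_forall fun t => ae_of_all _ fun σ _ => ?_) intervalIntegrable_const ?_
    · have : StronglyMeasurable (K t) :=
        (hmeas t).stronglyMeasurable.integral_prod_right (ν := volume)
      exact (this.comp_measurable (measurable_const_mul t)).aestronglyMeasurable
    · exact norm_integral_le_of_norm_le hG.norm (ae_of_all _ (hle t _))
    · filter_upwards [volume.ae_ne (1 : ℝ)] with σ hσ hσ'
      rw [Set.uIoc_of_le zero_le_one] at hσ'
      have hσ1 : 0 < 1 - σ := sub_pos.2 (lt_of_le_of_ne hσ'.2 hσ)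
      refine tendsto_integral_filter_of_dominated_convergence (fun q => ‖G q‖)
        (Eventually.of_forall fun t => ((hmeas t).comp measurable_prodMk_left).aestronglyMeasurable)
        (Eventually.of_forall fun t => ae_of_all _ (hle t _)) hG.norm (ae_of_all _ fun q => ?_)
      refine tendsto_const_nhds.congr' ?_
      have hmem : ∀ x : ℝ, ∀ᶠ t in atTop, t * σ - x ∈ Set.Icc 0 t := fun x => by
        filter_upwards [(tendsto_id.atTop_mul_const hσ'.1).eventually_ge_atTop x,
          (tendsto_id.atTop_mul_const hσ1).eventually_ge_atTop (-x)] with t h₁ h₂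
        simp only [id] at h₁ h₂
        exact ⟨by linarith, by linarith⟩
      filter_upwards [hmem q.1, hmem q.2] with t h₁ h₂
      rw [Set.indicator_of_mem (Set.mk_mem_prod h₁ h₂), Pi.one_apply, one_mul]
  rw [intervalIntegral.integral_const, sub_zero, one_smul] at hmain
  refine hmain.congr' ?_
  filter_upwards [eventually_gt_atTop 0] with t ht
  rw [integral_congr_ae (ae_of_all _ (hKeq t)),
    intervalIntegral.integral_comp_mul_left (K t) ht.ne', mul_zero, mul_one,
    intervalIntegral.integral_of_le ht.le, ← integral_Icc_eq_integral_Ioc, smul_eq_mul, one_div]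

theorem sin_add_sin_sub_sin_add (a b : ℝ) :
    sin (2 * a) + sin (2 * b) - sin (2 * (a + b)) = 4 * sin a * sin b * sin (a + b) := by
  simp only [sin_two_mul, sin_add, cos_add]
  linear_combination (-2 * sin a * cos a) * sin_sq_add_cos_sq b
    + (-2 * sin b * cos b) * sin_sq_add_cos_sq a

/-- The cyclic sine quotient, in terms of the differences `x = t₁ - t₂` and `z = t₁ - t₃`. -/
noncomputable def cyclicSineQuotient (V : ℝ) (q : ℝ × ℝ) : ℝ :=
  (sin (V * q.1) + sin (V * (q.2 - q.1)) + sin (V * -q.2)) / (q.1 * (q.2 - q.1) * q.2)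

theorem measurable_cyclicSineQuotient (V : ℝ) : Measurable (cyclicSineQuotient V) := by
  unfold cyclicSineQuotient
  fun_prop

theorem cyclicSineQuotient_eq_sincTriple {V : ℝ} (hV : V ≠ 0) {q : ℝ × ℝ} (h₁ : q.1 ≠ 0)
    (h₂ : q.2 ≠ 0) (h₃ : q.2 ≠ q.1) :
    cyclicSineQuotient V q = V ^ 3 / 2 * sincTriple ((V / 2) • q) := by
  obtain ⟨x, z⟩ := q
  have h₃' : z - x ≠ 0 := sub_ne_zero.2 h₃
  simp only at h₁ h₂
  have hs := sin_add_sin_sub_sin_add (V / 2 * x) (V / 2 * (z - x))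
  have e₁ : 2 * (V / 2 * x) = V * x := by ring
  have e₂ : 2 * (V / 2 * (z - x)) = V * (z - x) := by ring
  have e₃ : V / 2 * x + V / 2 * (z - x) = V / 2 * z := by ring
  have e₄ : 2 * (V / 2 * z) = V * z := by ring
  rw [e₁, e₂, e₃, e₄] at hs
  simp only [cyclicSineQuotient, sincTriple, Prod.smul_mk, smul_eq_mul, ← mul_sub, mul_neg, sin_neg,
    ← sub_eq_add_neg]
  rw [hs, sinc_of_ne_zero (by positivity), sinc_of_ne_zero (by positivity),
    sinc_of_ne_zero (by positivity)]
  field_simp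
  norm_num

theorem abs_cyclicSineQuotient_le {V : ℝ} (hV : V ≠ 0) (q : ℝ × ℝ) :
    |cyclicSineQuotient V q| ≤ |V ^ 3 / 2 * sincTriple ((V / 2) • q)| := by
  by_cases h : q.1 ≠ 0 ∧ q.2 ≠ 0 ∧ q.2 ≠ q.1
  · rw [cyclicSineQuotient_eq_sincTriple hV h.1 h.2.1 h.2.2]
  · have h0 : q.1 * (q.2 - q.1) * q.2 = 0 := by
      simp only [mul_eq_zero, sub_eq_zero]
      tauto
    rw [cyclicSineQuotient, h0, div_zero, abs_zero]
    exact abs_nonneg _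

theorem integrable_cyclicSineQuotient {V : ℝ} (hV : V ≠ 0) : Integrable (cyclicSineQuotient V) :=
  ((integrable_sincTriple.comp_smul (div_ne_zero hV two_ne_zero)).const_mul _).mono
    (measurable_cyclicSineQuotient V).aestronglyMeasurable
    (ae_of_all _ (abs_cyclicSineQuotient_le hV))

theorem integral_cyclicSineQuotient {V : ℝ} (hV : 0 < V) :
    ∫ q, cyclicSineQuotient V q = 2 * π ^ 2 * V := by
  have hint := (integrable_sincTriple.comp_smul (div_ne_zero hV.ne' two_ne_zero)).const_mul
    (V ^ 3 / 2)
  have hcongr : ∫ q, cyclicSineQuotient V q = ∫ q, V ^ 3 / 2 * sincTriple ((V / 2) • q) := by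
    rw [Measure.volume_eq_prod, integral_prod _ (integrable_cyclicSineQuotient hV.ne'),
      integral_prod _ hint]
    refine integral_congr_ae ?_
    filter_upwards [volume.ae_ne (0 : ℝ)] with x hx
    refine integral_congr_ae ?_
    filter_upwards [volume.ae_ne (0 : ℝ), volume.ae_ne x] with z hz hzx
    exact cyclicSineQuotient_eq_sincTriple hV.ne' hx hz hzx
  rw [hcongr, integral_const_mul, Measure.integral_comp_smul, integral_sincTriple,
    Module.finrank_prod, Module.finrank_self, abs_of_pos (by positivity), smul_eq_mul]
  field_simp
  ring

/-- For `V > 0`, with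
`F(t₁,t₂,t₃) = [sin V(t₁-t₂) + sin V(t₂-t₃) + sin V(t₃-t₁)] / ((t₁-t₂)(t₂-t₃)(t₁-t₃))`
(the value on the measure-zero set where the denominator vanishes being
irrelevant; division by zero is interpreted as `0`),
`(1/t) ∫_{[0,t]³} F → 2π²V` as `t → ∞`. -/
theorem stmt12 (V : ℝ) (hV : 0 < V) :
    Filter.Tendsto
      (fun t : ℝ => (1 / t) *
        ∫ p in (Set.Icc (0:ℝ) t ×ˢ Set.Icc (0:ℝ) t ×ˢ Set.Icc (0:ℝ) t : Set (ℝ × ℝ × ℝ)),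
          (Real.sin (V * (p.1 - p.2.1)) + Real.sin (V * (p.2.1 - p.2.2)) +
              Real.sin (V * (p.2.2 - p.1))) /
            ((p.1 - p.2.1) * (p.2.1 - p.2.2) * (p.1 - p.2.2)))
      Filter.atTop (nhds (2 * Real.pi ^ 2 * V)) := by
  have hfun : ∀ p : ℝ × ℝ × ℝ,
      (Real.sin (V * (p.1 - p.2.1)) + Real.sin (V * (p.2.1 - p.2.2)) +
          Real.sin (V * (p.2.2 - p.1))) /
        ((p.1 - p.2.1) * (p.2.1 - p.2.2) * (p.1 - p.2.2)) =
      cyclicSineQuotient V (p.1 - p.2.1, p.1 - p.2.2) := fun p => by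
    simp only [cyclicSineQuotient, sub_sub_sub_cancel_left, neg_sub]
  have hm := measurable_cyclicSineQuotient V
  rw [← integral_cyclicSineQuotient hV]
  refine (tendsto_average_integral_sub hm (integrable_cyclicSineQuotient hV.ne')).congr fun t => ?_
  simp_rw [hfun]
  congr 1
  have hint : IntegrableOn (fun p : ℝ × ℝ × ℝ => cyclicSineQuotient V (p.1 - p.2.1, p.1 - p.2.2))
      (Set.Icc 0 t ×ˢ Set.Icc 0 t ×ˢ Set.Icc 0 t) := by
    refine Measure.integrableOn_of_bounded (M := |V ^ 3 / 2|)
      (isCompact_Icc.prod (isCompact_Icc.prod isCompact_Icc)).measure_lt_top.ne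
      (hm.comp (by fun_prop)).aestronglyMeasurable (ae_of_all _ fun p => ?_)
    refine (abs_cyclicSineQuotient_le hV.ne' _).trans ?_
    rw [abs_mul]
    exact mul_le_of_le_one_right (abs_nonneg _) (abs_sincTriple_le_one _)
  exact (setIntegral_prod _ hint).symm
end

section
/- Let V > 0 and t > 0. Then the limit lim_{ε→0⁺} ∫_{[0,t]²} sin(V(t₃−t₁)) / (t₁ − t₃ − iε)² dt₁ dt₃ exists and equals −iπV·t. -/
open MeasureTheory Topology

theorem integrable_two_mul_sq_div_sq :
    Integrable (fun y : ℝ => 2 * y ^ 2 / (y ^ 2 + 1) ^ 2) := by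
  refine (integrable_inv_one_add_sq.const_mul 2).mono'
    (Continuous.aestronglyMeasurable (by fun_prop (disch := intro; positivity))) ?_
  refine Filter.Eventually.of_forall fun y => ?_
  rw [Real.norm_of_nonneg (by positivity), ← div_eq_mul_inv, div_le_div_iff₀ (by positivity)
    (by positivity)]
  nlinarith [sq_nonneg y, sq_nonneg (y ^ 2)]

open Filter in
theorem integral_two_mul_sq_div_sq :
    ∫ y : ℝ, 2 * y ^ 2 / (y ^ 2 + 1) ^ 2 = Real.pi := by
  have hinv : Tendsto (fun y : ℝ => y / (y ^ 2 + 1)) (cocompact ℝ) (𝓝 0) := by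
    refine squeeze_zero_norm (a := fun y : ℝ => ‖y‖⁻¹) (fun y => ?_)
      (tendsto_inv_atTop_zero.comp (tendsto_norm_cocompact_atTop (E := ℝ)))
    rcases eq_or_ne y 0 with rfl | hy
    · simp
    · have hy' : 0 < |y| := abs_pos.mpr hy
      rw [Real.norm_eq_abs, Real.norm_eq_abs, abs_div, abs_of_pos (by positivity : 0 < y ^ 2 + 1),
        inv_eq_one_div, div_le_div_iff₀ (by positivity) hy', ← sq, sq_abs]
      linarith
  have hderiv (y : ℝ) : HasDerivAt (fun y : ℝ => Real.arctan y - y / (y ^ 2 + 1))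
      (2 * y ^ 2 / (y ^ 2 + 1) ^ 2) y := by
    have hy : y ^ 2 + 1 ≠ 0 := by positivity
    have hy' : 1 + y ^ 2 ≠ 0 := by positivity
    refine ((Real.hasDerivAt_arctan y).sub
      ((hasDerivAt_id y).div ((hasDerivAt_pow 2 y).add_const 1) hy)).congr_deriv ?_
    simp only [id]
    field_simp
    push_cast
    ring
  have hbot : Tendsto (fun y : ℝ => Real.arctan y - y / (y ^ 2 + 1)) atBot
      (𝓝 (-(Real.pi / 2))) := by
    simpa using (Real.tendsto_arctan_atBot.mono_right nhdsWithin_le_nhds).sub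
      (hinv.mono_left atBot_le_cocompact)
  have htop : Tendsto (fun y : ℝ => Real.arctan y - y / (y ^ 2 + 1)) atTop
      (𝓝 (Real.pi / 2)) := by
    simpa using (Real.tendsto_arctan_atTop.mono_right nhdsWithin_le_nhds).sub
      (hinv.mono_left atTop_le_cocompact)
  rw [integral_of_hasDerivAt_of_tendsto hderiv integrable_two_mul_sq_div_sq hbot htop]
  ring

/-- The imaginary part of `sin (-V u) / (u - i ε) ^ 2`. -/
noncomputable def sinKernel (V ε u : ℝ) : ℝ :=
  -Real.sin (V * u) * (2 * u * ε) / (u ^ 2 + ε ^ 2) ^ 2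

theorem continuous_sinKernel (V : ℝ) {ε : ℝ} (hε : 0 < ε) : Continuous (sinKernel V ε) := by
  unfold sinKernel
  fun_prop (disch := intro; positivity)

theorem mul_sinKernel_mul (V : ℝ) {ε : ℝ} (hε : 0 < ε) (y : ℝ) :
    ε * sinKernel V ε (ε * y) =
      -(ε⁻¹ * Real.sin (V * y * ε)) * (2 * y / (y ^ 2 + 1) ^ 2) := by
  have hy : y ^ 2 + 1 ≠ 0 := by positivity
  have h : (ε * y) ^ 2 + ε ^ 2 = ε ^ 2 * (y ^ 2 + 1) := by ring
  rw [sinKernel, h, show V * (ε * y) = V * y * ε by ring]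
  field_simp

theorem norm_mul_sinKernel_mul_le {V ε : ℝ} (hV : 0 < V) (hε : 0 < ε) (y : ℝ) :
    ‖ε * sinKernel V ε (ε * y)‖ ≤ V * (2 * y ^ 2 / (y ^ 2 + 1) ^ 2) := by
  have hsin : |Real.sin (V * y * ε)| ≤ V * |y| * ε := by
    refine Real.abs_sin_le_abs.trans_eq ?_
    rw [abs_mul, abs_mul, abs_of_pos hV, abs_of_pos hε]
  rw [mul_sinKernel_mul V hε, Real.norm_eq_abs, abs_mul, abs_neg, abs_mul, abs_div, abs_mul,
    abs_of_pos (inv_pos.mpr hε), abs_of_pos (by positivity : 0 < (y ^ 2 + 1) ^ 2), abs_two]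
  calc ε⁻¹ * |Real.sin (V * y * ε)| * (2 * |y| / (y ^ 2 + 1) ^ 2)
      ≤ ε⁻¹ * (V * |y| * ε) * (2 * |y| / (y ^ 2 + 1) ^ 2) := by gcongr
    _ = V * (2 * |y| ^ 2 / (y ^ 2 + 1) ^ 2) := by field_simp
    _ = V * (2 * y ^ 2 / (y ^ 2 + 1) ^ 2) := by rw [sq_abs]

theorem tendsto_mul_sinKernel_mul (V y : ℝ) :
    Filter.Tendsto (fun ε : ℝ => ε * sinKernel V ε (ε * y)) (𝓝[>] 0)
      (𝓝 (-V * (2 * y ^ 2 / (y ^ 2 + 1) ^ 2))) := by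
  have hsin : HasDerivAt (fun ε : ℝ => Real.sin (V * y * ε)) (V * y) 0 := by
    simpa using ((hasDerivAt_id (0 : ℝ)).const_mul (V * y)).sin
  have hslope := hsin.tendsto_slope_zero_right
  simp only [zero_add, mul_zero, Real.sin_zero, sub_zero, smul_eq_mul] at hslope
  have hlim := hslope.neg.mul_const (2 * y / (y ^ 2 + 1) ^ 2)
  rw [show -V * (2 * y ^ 2 / (y ^ 2 + 1) ^ 2) = -(V * y) * (2 * y / (y ^ 2 + 1) ^ 2) by ring]
  refine hlim.congr' ?_
  filter_upwards [self_mem_nhdsWithin] with ε hε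
  exact (mul_sinKernel_mul V hε y).symm

theorem integral_Icc_sinKernel_sub (V : ℝ) {t ε : ℝ} (ht : 0 < t) (hε : 0 < ε) (s : ℝ) :
    ∫ x in Set.Icc 0 t, sinKernel V ε (x - s) =
      ∫ y, (Set.Ioc (-s / ε) ((t - s) / ε)).indicator
        (fun y => ε * sinKernel V ε (ε * y)) y := by
  have hle : -s / ε ≤ (t - s) / ε := by gcongr; linarith
  rw [integral_Icc_eq_integral_Ioc, ← intervalIntegral.integral_of_le ht.le,
    intervalIntegral.integral_comp_sub_right, integral_indicator measurableSet_Ioc,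
    ← intervalIntegral.integral_of_le hle, intervalIntegral.integral_const_mul,
    intervalIntegral.mul_integral_comp_mul_left]
  congr 1 <;> field_simp
  simp

theorem norm_integral_Icc_sinKernel_sub_le {V t ε : ℝ} (hV : 0 < V) (ht : 0 < t) (hε : 0 < ε)
    (s : ℝ) : ‖∫ x in Set.Icc 0 t, sinKernel V ε (x - s)‖ ≤ V * Real.pi := by
  rw [integral_Icc_sinKernel_sub V ht hε, ← integral_two_mul_sq_div_sq, ← integral_const_mul]
  exact norm_integral_le_of_norm_le (integrable_two_mul_sq_div_sq.const_mul V)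
    (.of_forall fun y => (norm_indicator_le_norm_self _ _).trans
      (norm_mul_sinKernel_mul_le hV hε y))

theorem tendsto_integral_Icc_sinKernel_sub {V t s : ℝ} (hV : 0 < V) (hs : s ∈ Set.Ioo 0 t) :
    Filter.Tendsto (fun ε : ℝ => ∫ x in Set.Icc 0 t, sinKernel V ε (x - s)) (𝓝[>] 0)
      (𝓝 (-V * Real.pi)) := by
  have ht : 0 < t := hs.1.trans hs.2
  rw [← integral_two_mul_sq_div_sq, ← integral_const_mul]
  refine Filter.Tendsto.congr' (f₁ := fun ε : ℝ => ∫ y,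
    (Set.Ioc (-s / ε) ((t - s) / ε)).indicator (fun y => ε * sinKernel V ε (ε * y)) y) ?_ ?_
  · filter_upwards [self_mem_nhdsWithin] with ε hε
    exact (integral_Icc_sinKernel_sub V ht hε s).symm
  refine tendsto_integral_filter_of_dominated_convergence _ ?_ ?_
    (integrable_two_mul_sq_div_sq.const_mul V) ?_
  · filter_upwards [self_mem_nhdsWithin] with ε hε
    have hcont := continuous_sinKernel V hε
    exact (Continuous.aestronglyMeasurable (by fun_prop)).indicator measurableSet_Ioc
  · filter_upwards [self_mem_nhdsWithin] with ε hε
    exact .of_forall fun y => (norm_indicator_le_norm_self _ _).trans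
      (norm_mul_sinKernel_mul_le hV hε y)
  · refine .of_forall fun y => (tendsto_mul_sinKernel_mul V y).congr' ?_
    have hmul : Filter.Tendsto (fun ε : ℝ => y * ε) (𝓝[>] 0) (𝓝 0) := by
      have h : Continuous fun ε : ℝ => y * ε := by fun_prop
      simpa using (h.tendsto 0).mono_left nhdsWithin_le_nhds
    filter_upwards [self_mem_nhdsWithin, hmul.eventually_const_lt (neg_lt_zero.mpr hs.1),
      hmul.eventually_lt_const (sub_pos.mpr hs.2)] with ε hε hlow hhigh
    have hε' : 0 < ε := hε
    rw [Set.indicator_of_mem]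
    exact ⟨(div_lt_iff₀ hε').mpr hlow, (le_div_iff₀ hε').mpr hhigh.le⟩

theorem integrableOn_sinKernel_sub (V t : ℝ) {ε : ℝ} (hε : 0 < ε) :
    IntegrableOn (fun p : ℝ × ℝ => sinKernel V ε (p.1 - p.2))
      (Set.Icc 0 t ×ˢ Set.Icc 0 t) := by
  have hcont := continuous_sinKernel V hε
  exact ContinuousOn.integrableOn_compact (isCompact_Icc.prod isCompact_Icc)
    (Continuous.continuousOn (by fun_prop))

theorem tendsto_integral_sinKernel_sub {V t : ℝ} (hV : 0 < V) (ht : 0 < t) :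
    Filter.Tendsto (fun ε : ℝ => ∫ p in Set.Icc (0 : ℝ) t ×ˢ Set.Icc (0 : ℝ) t,
      sinKernel V ε (p.1 - p.2)) (𝓝[>] 0) (𝓝 (-Real.pi * V * t)) := by
  have hint (ε : ℝ) (hε : 0 < ε) : Integrable (fun p : ℝ × ℝ => sinKernel V ε (p.1 - p.2))
      ((volume.restrict (Set.Icc 0 t)).prod (volume.restrict (Set.Icc 0 t))) := by
    rw [Measure.prod_restrict, ← Measure.volume_eq_prod]
    exact integrableOn_sinKernel_sub V t hε
  have hconst : ∫ _ in Set.Icc (0 : ℝ) t, -V * Real.pi = -Real.pi * V * t := by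
    rw [setIntegral_const, Real.volume_real_Icc_of_le ht.le, smul_eq_mul]
    ring
  rw [← hconst]
  refine Filter.Tendsto.congr' (f₁ := fun ε : ℝ => ∫ s in Set.Icc (0 : ℝ) t,
    ∫ x in Set.Icc (0 : ℝ) t, sinKernel V ε (x - s)) ?_ ?_
  · filter_upwards [self_mem_nhdsWithin] with ε hε
    rw [Measure.volume_eq_prod, ← Measure.prod_restrict, integral_prod_symm _ (hint ε hε)]
  refine tendsto_integral_filter_of_dominated_convergence (fun _ => V * Real.pi) ?_ ?_
    (integrable_const _) ?_
  · filter_upwards [self_mem_nhdsWithin] with ε hε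
    exact (hint ε hε).integral_prod_right.aestronglyMeasurable
  · filter_upwards [self_mem_nhdsWithin] with ε hε
    exact .of_forall (norm_integral_Icc_sinKernel_sub_le hV ht hε)
  · have hmem : ∀ᵐ s ∂volume.restrict (Set.Icc 0 t), s ∈ Set.Ioo 0 t := by
      rw [← restrict_Ioo_eq_restrict_Icc]
      exact ae_restrict_mem measurableSet_Ioo
    filter_upwards [hmem] with s hs
    exact tendsto_integral_Icc_sinKernel_sub hV hs

theorem ofReal_sub_mul_I_ne_zero (u : ℝ) {ε : ℝ} (hε : ε ≠ 0) :
    (u : ℂ) - ε * Complex.I ≠ 0 := fun h => hε (by simpa using congrArg Complex.im h)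

/-- Symmetrizing under `(t₁, t₃) ↦ (t₃, t₁)` leaves only the imaginary part. -/
theorem sin_div_sq_add_swap (V : ℝ) {ε : ℝ} (hε : 0 < ε) (x s : ℝ) :
    (Real.sin (V * (s - x)) : ℂ) / ((x : ℂ) - s - ε * Complex.I) ^ 2 +
      (Real.sin (V * (x - s)) : ℂ) / ((s : ℂ) - x - ε * Complex.I) ^ 2 =
      2 * Complex.I * (sinKernel V ε (x - s) : ℂ) := by
  obtain ⟨u, rfl⟩ : ∃ u, x = s + u := ⟨x - s, by ring⟩
  have hneg : (u : ℂ) - ε * Complex.I ≠ 0 := ofReal_sub_mul_I_ne_zero u hε.ne'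
  have hpos : (u : ℂ) + ε * Complex.I ≠ 0 := by
    simpa using ofReal_sub_mul_I_ne_zero u (neg_ne_zero.mpr hε.ne')
  have hmul : (u : ℂ) ^ 2 + (ε : ℂ) ^ 2 = (u - ε * Complex.I) * (u + ε * Complex.I) := by
    ring_nf
    simp
  rw [show V * (s - (s + u)) = -(V * u) by ring, show s + u - s = u by ring, Real.sin_neg,
    show ((s + u : ℝ) : ℂ) - s - ε * Complex.I = u - ε * Complex.I by push_cast; ring,
    show (s : ℂ) - (s + u : ℝ) - ε * Complex.I = -(u + ε * Complex.I) by push_cast; ring,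
    sinKernel, neg_sq]
  push_cast
  rw [hmul]
  field_simp
  ring

theorem integral_sin_div_sq (V t : ℝ) {ε : ℝ} (hε : 0 < ε) :
    ∫ p in (Set.Icc (0:ℝ) t ×ˢ Set.Icc (0:ℝ) t : Set (ℝ × ℝ)),
      (Real.sin (V * (p.2 - p.1)) : ℂ) / ((p.1 : ℂ) - p.2 - ε * Complex.I) ^ 2 =
      Complex.I * (∫ p in (Set.Icc (0:ℝ) t ×ˢ Set.Icc (0:ℝ) t : Set (ℝ × ℝ)),
        sinKernel V ε (p.1 - p.2) : ℝ) := by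
  set f : ℝ × ℝ → ℂ := fun p =>
    (Real.sin (V * (p.2 - p.1)) : ℂ) / ((p.1 : ℂ) - p.2 - ε * Complex.I) ^ 2
  set S : Set (ℝ × ℝ) := Set.Icc (0:ℝ) t ×ˢ Set.Icc (0:ℝ) t with hS
  have hcont : Continuous f := by
    refine Continuous.div (by fun_prop) (by fun_prop) fun p => pow_ne_zero 2 ?_
    simpa using ofReal_sub_mul_I_ne_zero (p.1 - p.2) hε.ne'
  have hcompact : IsCompact S := isCompact_Icc.prod isCompact_Icc
  have hswap : ∫ p in S, f p.swap = ∫ p in S, f p := by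
    rw [hS, Measure.volume_eq_prod, setIntegral_prod_swap]
  have hsum : ∫ p in S, (f p + f p.swap) =
      2 * Complex.I * (∫ p in S, sinKernel V ε (p.1 - p.2) : ℝ) := by
    rw [← integral_complex_ofReal, ← integral_const_mul]
    exact integral_congr_ae (.of_forall fun p => sin_div_sq_add_swap V hε p.1 p.2)
  rw [integral_add (f := f) (g := fun p => f p.swap)
    (hcont.continuousOn.integrableOn_compact hcompact)
    ((hcont.comp continuous_swap).continuousOn.integrableOn_compact hcompact), hswap] at hsum
  linear_combination hsum / 2

/-- For `V > 0` and `t > 0`: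
`lim_{ε→0⁺} ∫_{[0,t]²} sin(V(t₃-t₁)) / (t₁ - t₃ - iε)² dt₁ dt₃ = -iπV t`. -/
theorem stmt13 (V t : ℝ) (hV : 0 < V) (ht : 0 < t) :
    Filter.Tendsto
      (fun ε : ℝ =>
        ∫ p in (Set.Icc (0:ℝ) t ×ˢ Set.Icc (0:ℝ) t : Set (ℝ × ℝ)),
          (Real.sin (V * (p.2 - p.1)) : ℂ) / ((p.1 : ℂ) - p.2 - ε * Complex.I) ^ 2)
      (𝓝[>] (0:ℝ)) (nhds (-Complex.I * Real.pi * V * t)) := by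
  have hlim := ((Complex.continuous_ofReal.tendsto _).comp
    (tendsto_integral_sinKernel_sub hV ht)).const_mul Complex.I
  have hval : Complex.I * ((-Real.pi * V * t : ℝ) : ℂ) = -Complex.I * Real.pi * V * t := by
    push_cast
    ring
  rw [hval] at hlim
  refine hlim.congr' ?_
  filter_upwards [self_mem_nhdsWithin] with ε hε
  exact (integral_sin_div_sq V t hε).symm
end

section
/- Let f : ℝ → ℂ be continuously differentiable with compact support. Then lim_{ε→0⁺} ∫_ℝ f(x) · ( (x+iε)^{−2} − (x−iε)^{−2} )/2 dx = −iπ·f'(0). (Equivalently, the odd part of the distribution (x + i0)^{−2} is πi·δ'(x).) -/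
open MeasureTheory Topology

/-- The Poisson kernel `ε / (π (x² + ε²))` is an approximate identity as `ε → 0⁺`. -/
theorem tendsto_integral_poissonKernel_smul {E : Type*} [NormedAddCommGroup E] [NormedSpace ℝ E]
    [CompleteSpace E] {g : ℝ → E} (hg : Integrable g) (hg₀ : ContinuousAt g 0) :
    Filter.Tendsto (fun ε : ℝ => ∫ x : ℝ, (ε⁻¹ * (Real.pi⁻¹ * (1 + (ε⁻¹ * x) ^ 2)⁻¹)) • g x)
      (𝓝[>] (0 : ℝ)) (𝓝 (g 0)) := by
  have decay : Filter.Tendsto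
      (fun x : ℝ => ‖x‖ ^ Module.finrank ℝ ℝ * (Real.pi⁻¹ * (1 + x ^ 2)⁻¹))
      (Bornology.cobounded ℝ) (𝓝 0) := by
    have lim : Filter.Tendsto (fun x : ℝ => Real.pi⁻¹ * ‖x‖⁻¹)
        (Bornology.cobounded ℝ) (𝓝 0) := by
      simpa using (tendsto_norm_cobounded_atTop (E := ℝ)).inv_tendsto_atTop.const_mul Real.pi⁻¹
    refine squeeze_zero' (.of_forall fun x => by positivity) ?_ lim
    filter_upwards [tendsto_norm_cobounded_atTop.eventually (Filter.eventually_gt_atTop (0 : ℝ))]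
      with x hx
    have bound : ‖x‖ * (1 + x ^ 2)⁻¹ ≤ ‖x‖⁻¹ := by
      rw [← div_eq_mul_inv, div_le_iff₀ (by positivity), inv_mul_eq_div, le_div_iff₀ hx,
        Real.norm_eq_abs, abs_mul_abs_self]
      nlinarith
    calc ‖x‖ ^ Module.finrank ℝ ℝ * (Real.pi⁻¹ * (1 + x ^ 2)⁻¹)
        = Real.pi⁻¹ * (‖x‖ * (1 + x ^ 2)⁻¹) := by
          rw [Module.finrank_self, pow_one]; ring
      _ ≤ Real.pi⁻¹ * ‖x‖⁻¹ := by gcongr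
  have mass : ∫ x : ℝ, Real.pi⁻¹ * (1 + x ^ 2)⁻¹ = 1 := by
    rw [integral_const_mul, integral_univ_inv_one_add_sq, inv_mul_cancel₀ Real.pi_ne_zero]
  have key := tendsto_integral_comp_smul_smul_of_integrable
    (fun x => by positivity) mass decay hg hg₀
  simpa [Function.comp_def] using key.comp tendsto_inv_nhdsGT_zero

/-- For nonzero real `ε`, `x ↦ (x + iε)⁻¹` has derivative `-(x + iε)⁻²` on the real line. -/
theorem hasDerivAt_inv_ofReal_add_mul_I {ε : ℝ} (hε : ε ≠ 0) (x : ℝ) :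
    HasDerivAt (fun y : ℝ => ((y : ℂ) + ε * Complex.I)⁻¹)
      (-(((x : ℂ) + ε * Complex.I) ^ 2)⁻¹) x := by
  have ne : (x : ℂ) + ε * Complex.I ≠ 0 := fun h => hε (by simpa using congrArg Complex.im h)
  have line : HasDerivAt (fun y : ℝ => (y : ℂ) + ε * Complex.I) 1 x :=
    (Complex.ofRealCLM.hasDerivAt (x := x)).add_const (ε * Complex.I)
  exact (line.fun_inv ne).congr_deriv (by rw [neg_div, one_div])

/-- The difference of the two boundary kernels `(x ∓ iε)⁻¹` is a multiple of the Poisson kernel. -/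
theorem inv_sub_inv_eq_poissonKernel {ε : ℝ} (hε : ε ≠ 0) (x : ℝ) :
    (((x : ℂ) + (-ε : ℝ) * Complex.I)⁻¹ - ((x : ℂ) + ε * Complex.I)⁻¹) / 2 =
      Complex.I * Real.pi * (ε⁻¹ * (Real.pi⁻¹ * (1 + (ε⁻¹ * x) ^ 2)⁻¹) : ℝ) := by
  have ne : (x : ℂ) + ε * Complex.I ≠ 0 := fun h => hε (by simpa using congrArg Complex.im h)
  have ne' : (x : ℂ) + (-ε : ℝ) * Complex.I ≠ 0 :=
    fun h => hε (by simpa using congrArg Complex.im h)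
  have hpi : (Real.pi : ℂ) ≠ 0 := Complex.ofReal_ne_zero.mpr Real.pi_ne_zero
  have hε' : (ε : ℂ) ≠ 0 := Complex.ofReal_ne_zero.mpr hε
  have factor : ((x : ℂ) + (-ε : ℝ) * Complex.I) * ((x : ℂ) + ε * Complex.I) =
      (ε : ℂ) ^ 2 + (x : ℂ) ^ 2 := by
    push_cast
    linear_combination (-(ε : ℂ) ^ 2) * Complex.I_sq
  have ne_sq : (ε : ℂ) ^ 2 + (x : ℂ) ^ 2 ≠ 0 := factor ▸ mul_ne_zero ne' ne
  have kernel : (1 + ((ε : ℂ)⁻¹ * x) ^ 2)⁻¹ = ε ^ 2 / ((ε : ℂ) ^ 2 + (x : ℂ) ^ 2) := by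
    rw [← inv_div]
    congr 1
    field_simp
  rw [inv_sub_inv ne' ne, factor]
  push_cast
  rw [kernel]
  field_simp
  ring

/-- For `f : ℝ → ℂ` continuously differentiable with compact support,
`lim_{ε→0⁺} ∫_ℝ f(x) ((x+iε)⁻² - (x-iε)⁻²)/2 dx = -iπ f'(0)`; that is,
the odd part of the distribution `(x + i0)⁻²` is `πi δ'(x)`. -/
theorem stmt17 (f : ℝ → ℂ) (hf : ContDiff ℝ 1 f) (hsupp : HasCompactSupport f) :
    Filter.Tendsto
      (fun ε : ℝ =>
        ∫ x : ℝ, f x *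
          ((((x : ℂ) + ε * Complex.I) ^ 2)⁻¹ - (((x : ℂ) - ε * Complex.I) ^ 2)⁻¹) / 2)
      (𝓝[>] (0:ℝ)) (nhds (-Complex.I * Real.pi * deriv f 0)) := by
  have hf' : Continuous (deriv f) := hf.continuous_deriv le_rfl
  have hf'_int : Integrable (deriv f) := hf'.integrable_of_hasCompactSupport hsupp.deriv
  refine ((tendsto_integral_poissonKernel_smul hf'_int hf'.continuousAt).const_mul
    (-Complex.I * Real.pi)).congr' ?_
  filter_upwards [self_mem_nhdsWithin] with ε hε
  have hε₀ : ε ≠ 0 := ne_of_gt hε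
  let u : ℝ → ℂ := fun x =>
    (((x : ℂ) + (-ε : ℝ) * Complex.I)⁻¹ - ((x : ℂ) + ε * Complex.I)⁻¹) / 2
  let u' : ℝ → ℂ := fun x =>
    (-(((x : ℂ) + (-ε : ℝ) * Complex.I) ^ 2)⁻¹ - -(((x : ℂ) + ε * Complex.I) ^ 2)⁻¹) / 2
  have hu (x : ℝ) : HasDerivAt u (u' x) x :=
    ((hasDerivAt_inv_ofReal_add_mul_I (neg_ne_zero.mpr hε₀) x).sub
      (hasDerivAt_inv_ofReal_add_mul_I hε₀ x)).div_const 2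
  have hu_cont : Continuous u := continuous_iff_continuousAt.mpr fun x => (hu x).continuousAt
  have hu'_cont : Continuous u' := by
    have ne (η : ℝ) (hη : η ≠ 0) (x : ℝ) : ((x : ℂ) + η * Complex.I) ^ 2 ≠ 0 :=
      pow_ne_zero 2 fun h => hη (by simpa using congrArg Complex.im h)
    have cont (η : ℝ) (hη : η ≠ 0) :
        Continuous fun x : ℝ => (((x : ℂ) + η * Complex.I) ^ 2)⁻¹ :=
      Continuous.inv₀ (by fun_prop) (ne η hη)
    exact ((cont _ (neg_ne_zero.mpr hε₀)).neg.sub (cont _ hε₀).neg).div_const 2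
  have parts : ∫ x, f x * u' x = -∫ x, deriv f x * u x :=
    integral_mul_deriv_eq_deriv_mul_of_integrable
      (fun x _ => (hf.differentiable one_ne_zero x).hasDerivAt) (fun x _ => hu x)
      ((hf.continuous.mul hu'_cont).integrable_of_hasCompactSupport hsupp.mul_right)
      ((hf'.mul hu_cont).integrable_of_hasCompactSupport hsupp.deriv.mul_right)
      ((hf.continuous.mul hu_cont).integrable_of_hasCompactSupport hsupp.mul_right)
  calc -Complex.I * Real.pi *
        ∫ x : ℝ, (ε⁻¹ * (Real.pi⁻¹ * (1 + (ε⁻¹ * x) ^ 2)⁻¹)) • deriv f x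
      = -∫ x, deriv f x * u x := by
        rw [← integral_const_mul, ← integral_neg]
        congr 1 with x : 1
        simp only [u, inv_sub_inv_eq_poissonKernel hε₀, Complex.real_smul]
        ring
    _ = ∫ x, f x * u' x := parts.symm
    _ = _ := by
        congr 1 with x : 1
        simp only [u', Complex.ofReal_neg]
        ring
end
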